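/- For every n ≥ 3, the number of arithmetical structures on the bident D_n satisfies |Arith(D_n)| = 2·C(n−2) + Σ_{m=4}^{n} B(n−3, n−m)·|SArith(D_m)| (the sum being empty when n = 3). -/

import Mathlib

/-- `IsArith n dx dy d rx ry r` says that `(d, r)` is an arithmetical structure on the
bident `D_n` (with `ℓ = n - 3`): `dx, dy, rx, ry` are the values at the prong vertices
`v_x, v_y`, and `d i, r i` (for `0 ≤ i ≤ n - 3`) are the values at the path vertices
`v_0, v_1, …, v_ℓ`. -/
def IsArith (n dx dy : ℕ) (d : ℕ → ℕ) (rx ry : ℕ) (r : ℕ → ℕ) : Prop :=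
  3 ≤ n ∧
  0 < dx ∧ 0 < dy ∧ (∀ i, i ≤ n - 3 → 0 < d i) ∧
  0 < rx ∧ 0 < ry ∧ (∀ i, i ≤ n - 3 → 0 < r i) ∧
  dx * rx = r 0 ∧ dy * ry = r 0 ∧
  (1 ≤ n - 3 → d 0 * r 0 = rx + ry + r 1) ∧
  (n - 3 = 0 → d 0 * r 0 = rx + ry) ∧
  (∀ i, 1 ≤ i → i + 1 ≤ n - 3 → d i * r i = r (i - 1) + r (i + 1)) ∧
  (1 ≤ n - 3 → d (n - 3) * r (n - 3) = r (n - 3 - 1)) ∧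
  (∀ c : ℕ, c ∣ rx → c ∣ ry → (∀ i, i ≤ n - 3 → c ∣ r i) → c = 1)

/-- An arithmetical structure on `D_n` is *smooth* if `d_x, d_y ≥ 2` and `d_i ≥ 2` for all
`1 ≤ i ≤ ℓ = n - 3`. -/
def IsSmooth (n dx dy : ℕ) (d : ℕ → ℕ) : Prop :=
  2 ≤ dx ∧ 2 ≤ dy ∧ ∀ i, 1 ≤ i → i ≤ n - 3 → 2 ≤ d i

/-- The type of arithmetical structures on the bident `D_n`, represented canonically:
the label functions `d, r` are required to vanish beyond index `n - 3`. -/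
structure ArithOn (n : ℕ) where
  dx : ℕ
  dy : ℕ
  d : ℕ → ℕ
  rx : ℕ
  ry : ℕ
  r : ℕ → ℕ
  arith : IsArith n dx dy d rx ry r
  d_pad : ∀ i, n - 3 < i → d i = 0
  r_pad : ∀ i, n - 3 < i → r i = 0

/-- The type of smooth arithmetical structures on the bident `D_n`, represented canonically. -/
structure SmoothArithOn (n : ℕ) where
  dx : ℕ
  dy : ℕ
  d : ℕ → ℕ
  rx : ℕ
  ry : ℕ
  r : ℕ → ℕ
  arith : IsArith n dx dy d rx ry r
  smooth : IsSmooth n dx dy d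
  d_pad : ∀ i, n - 3 < i → d i = 0
  r_pad : ∀ i, n - 3 < i → r i = 0

/-- The ballot number `B(n, k) = ((n - k + 1)/(n + 1)) * choose (n + k) n`
(the division is exact for `k ≤ n`). -/
def ballot (n k : ℕ) : ℕ := (n - k + 1) * Nat.choose (n + k) n / (n + 1)


/-- Number of ways to grow a path tail of length `s` to one of length `N` by insertions so that
the first `j` tail vertices carry no insertion, as a difference of binomial coefficients. -/
def insertionCount (N j s : ℕ) : ℤ :=
  ((2 * N - s - 1 - j).choose (N - s) : ℤ) - ((2 * N - s - 1 - j).choose (N + 1) : ℤ)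

theorem insertionCount_self (N j : ℕ) : insertionCount N j N = 1 := by
  have h : (2 * N - N - 1 - j).choose (N + 1) = 0 := Nat.choose_eq_zero_of_lt (by omega)
  simp [insertionCount, h]

theorem insertionCount_diag_of_lt {N s : ℕ} (h : s < N) : insertionCount N N s = 0 := by
  have h1 : (2 * N - s - 1 - N).choose (N - s) = 0 := Nat.choose_eq_zero_of_lt (by omega)
  have h2 : (2 * N - s - 1 - N).choose (N + 1) = 0 := Nat.choose_eq_zero_of_lt (by omega)
  simp [insertionCount, h1, h2]

theorem insertionCount_succ {N j s : ℕ} (hj : j ≤ N) (hs : s ≤ N) :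
    insertionCount (N + 1) j s = insertionCount (N + 1) (j + 1) s + insertionCount N (j - 1) s := by
  obtain ⟨k, rfl⟩ := Nat.exists_eq_add_of_le hs
  unfold insertionCount
  rw [show 2 * (s + k + 1) - s - 1 - j = (s + 2 * k - j) + 1 by omega,
    show 2 * (s + k + 1) - s - 1 - (j + 1) = s + 2 * k - j by omega,
    show s + k + 1 - s = k + 1 by omega, show s + k - s = k by omega,
    Nat.choose_succ_succ, Nat.choose_succ_succ]
  rcases j with _ | j
  · rcases Nat.eq_zero_or_pos k with rfl | hk
    · have h : (2 * (s + 0) - s - 1).choose (s + 0 + 1) = 0 :=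
        Nat.choose_eq_zero_of_lt (by omega)
      simp only [add_zero] at h
      simp [h]
      ring
    · obtain ⟨k, rfl⟩ := Nat.exists_eq_succ_of_ne_zero hk.ne'
      have hsymm : (s + 2 * k + 1).choose k = (s + 2 * k + 1).choose (s + k + 1) :=
        Nat.choose_symm_of_eq_add (by omega)
      rw [show s + 2 * (k + 1) - 0 = (s + 2 * k + 1) + 1 by omega,
        show 2 * (s + (k + 1)) - s - 1 - (0 - 1) = s + 2 * k + 1 by omega,
        show s + (k + 1) = s + k + 1 by omega]
      have e1 := Nat.choose_succ_succ (s + 2 * k + 1) k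
      have e2 := Nat.choose_succ_succ (s + 2 * k + 1) (s + k + 1)
      simp only [Nat.succ_eq_add_one] at *
      push_cast [e1, e2, hsymm]
      ring
  · rw [show 2 * (s + k) - s - 1 - (j + 1 - 1) = s + 2 * k - (j + 1) by omega]
    push_cast
    ring

theorem eq_sum_insertionCount {Y : ℕ → ℕ → ℕ}
    (hY : ∀ N j, j ≤ N → Y (N + 1) j = Y (N + 1) (j + 1) + Y N (j - 1)) (N j : ℕ) (hj : j ≤ N) :
    (Y N j : ℤ) = ∑ s ∈ Finset.range (N + 1), insertionCount N j s * Y s s := by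
  induction N generalizing j with
  | zero =>
    obtain rfl : j = 0 := by omega
    simp [insertionCount]
  | succ N ih =>
    induction hj using Nat.decreasingInduction with
    | self =>
      rw [Finset.sum_range_succ, insertionCount_self, Finset.sum_eq_zero]
      · simp
      · intro s hs
        rw [insertionCount_diag_of_lt (Finset.mem_range.1 hs), zero_mul]
    | of_succ j hj ihj =>
      rw [hY N j (by omega), Nat.cast_add, ihj, ih (j - 1) (by omega),
        Finset.sum_range_succ _ (N + 1), Finset.sum_range_succ _ (N + 1),
        insertionCount_self, insertionCount_self, add_right_comm, ← Finset.sum_add_distrib]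
      congr 1
      refine Finset.sum_congr rfl fun s hs => ?_
      rw [insertionCount_succ (Nat.lt_succ_iff.1 hj) (Finset.mem_range_succ_iff.1 hs), add_mul]

theorem cast_ballot {n k : ℕ} (h : k ≤ n) :
    (ballot n k : ℤ) = ((n + k).choose n : ℤ) - ((n + k).choose (n + 1) : ℤ) := by
  have h1 : (n + k).choose (n + 1) * (n + 1) = (n + k).choose n * k := by
    rw [Nat.choose_succ_right_eq, Nat.add_sub_cancel_left]
  have hle : (n + k).choose (n + 1) ≤ (n + k).choose n := by
    refine Nat.le_of_mul_le_mul_right (h1.trans_le ?_) n.succ_pos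
    exact Nat.mul_le_mul_left _ (by omega)
  have h2 : ballot n k = (n + k).choose n - (n + k).choose (n + 1) := by
    refine Nat.div_eq_of_eq_mul_left n.succ_pos ?_
    rw [Nat.sub_mul, h1, ← Nat.mul_sub, mul_comm, Nat.sub_add_comm h]
  rw [h2, Nat.cast_sub hle]

theorem insertionCount_zero_eq_ballot {N s : ℕ} (h : s ≤ N) :
    insertionCount N 0 s = ballot N (N - s) := by
  obtain ⟨k, rfl⟩ := Nat.exists_eq_add_of_le h
  rw [cast_ballot (by omega), insertionCount, Nat.add_sub_cancel_left]
  rcases Nat.eq_zero_or_pos (s + k) with h0 | h0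
  · obtain ⟨rfl, rfl⟩ : s = 0 ∧ k = 0 := by omega
    simp
  · obtain ⟨N, hN⟩ := Nat.exists_eq_succ_of_ne_zero h0.ne'
    have hsymm : (N + k).choose k = (N + k).choose N := Nat.choose_symm_of_eq_add (by omega)
    rw [hN, show 2 * N.succ - s - 1 - 0 = N + k by omega,
      show N.succ + k = (N + k) + 1 by omega, Nat.choose_succ_succ, Nat.choose_succ_succ, hsymm]
    push_cast
    ring

theorem sum_range_ballot {n K : ℕ} (h : K ≤ n) :
    ∑ k ∈ Finset.range (K + 1), (ballot n k : ℤ) = ballot (n + 1) K := by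
  induction K with
  | zero => simp [cast_ballot]
  | succ K ih =>
    rw [Finset.sum_range_succ, ih (by omega), cast_ballot (by omega), cast_ballot (by omega),
      cast_ballot (by omega), show n + 1 + (K + 1) = (n + 1 + K) + 1 by omega,
      show n + (K + 1) = n + 1 + K by omega, Nat.choose_succ_succ, Nat.choose_succ_succ]
    push_cast
    ring

theorem sum_range_ballot_eq_catalan (n : ℕ) :
    ∑ k ∈ Finset.range (n + 1), ballot n k = catalan (n + 1) := by
  have hsymm : (2 * n + 1).choose (n + 1) = (2 * n + 1).choose n :=
    Nat.choose_symm_of_eq_add (by omega)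
  have hdiag : (ballot (n + 1) n : ℤ) = ballot (n + 1) (n + 1) := by
    rw [cast_ballot (by omega), cast_ballot le_rfl,
      show n + 1 + (n + 1) = (2 * n + 1) + 1 by omega, show n + 1 + n = 2 * n + 1 by omega,
      Nat.choose_succ_succ (2 * n + 1), Nat.choose_succ_succ (2 * n + 1), hsymm]
    push_cast
    ring
  have h := (sum_range_ballot (le_refl n)).trans hdiag
  rw [show catalan (n + 1) = ballot (n + 1) (n + 1) by
    rw [catalan_eq_centralBinom_div, ballot, Nat.centralBinom, Nat.sub_self, ← two_mul]; simp]
  exact_mod_cast h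

/-- Primitive positive vectors `r` on the bident whose path has vertices `0, …, N` (extended by
zero) admitting a compatible `d`: each entry divides the sum of the neighbouring entries. -/
structure IsBidentVec (N rx ry : ℕ) (r : ℕ → ℕ) : Prop where
  rx_pos : 0 < rx
  ry_pos : 0 < ry
  pos : ∀ i, i ≤ N → 0 < r i
  pad : ∀ i, N < i → r i = 0
  dvd_x : rx ∣ r 0
  dvd_y : ry ∣ r 0
  dvd_zero : r 0 ∣ rx + ry + r 1
  dvd : ∀ i, i < N → r (i + 1) ∣ r i + r (i + 2)
  primitive : ∀ c : ℕ, c ∣ rx → c ∣ ry → (∀ i, c ∣ r i) → c = 1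

/-- The label at path vertex `i` determined by the vector `r`. -/
def bidentLabel (rx ry : ℕ) (r : ℕ → ℕ) (i : ℕ) : ℕ :=
  if i = 0 then (rx + ry + r 1) / r 0 else (r (i - 1) + r (i + 1)) / r i

theorem IsArith.succ_mul {N dx dy rx ry : ℕ} {d r : ℕ → ℕ}
    (h : IsArith (N + 3) dx dy d rx ry r) (hr : ∀ i, N < i → r i = 0) {i : ℕ} (hi : i < N) :
    d (i + 1) * r (i + 1) = r i + r (i + 2) := by
  obtain ⟨-, -, -, -, -, -, -, -, -, -, -, h1, h2, -⟩ := h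
  simp only [Nat.add_sub_cancel] at h1 h2
  rcases Nat.lt_or_ge (i + 1) N with hlt | hge
  · simpa using h1 (i + 1) (by omega) hlt
  · obtain rfl : N = i + 1 := by omega
    simpa [hr (i + 2) (by omega)] using h2 (by omega)

theorem IsArith.zero_mul' {N dx dy rx ry : ℕ} {d r : ℕ → ℕ}
    (h : IsArith (N + 3) dx dy d rx ry r) (hr : ∀ i, N < i → r i = 0) :
    d 0 * r 0 = rx + ry + r 1 := by
  obtain ⟨-, -, -, -, -, -, -, -, -, h1, h2, -⟩ := h
  simp only [Nat.add_sub_cancel] at h1 h2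
  rcases Nat.eq_zero_or_pos N with hN | hN
  · rw [hr 1 (by omega), h2 hN, add_zero]
  · exact h1 hN

theorem IsArith.isBidentVec {N dx dy rx ry : ℕ} {d r : ℕ → ℕ}
    (h : IsArith (N + 3) dx dy d rx ry r) (hr : ∀ i, N < i → r i = 0) :
    IsBidentVec N rx ry r := by
  have h0 := h.zero_mul' hr
  have hs := fun i hi => h.succ_mul hr (i := i) hi
  obtain ⟨-, -, -, -, hrx, hry, hpos, hx, hy, -, -, -, -, hprim⟩ := h
  exact ⟨hrx, hry, hpos, hr, ⟨dx, by rw [← hx, mul_comm]⟩, ⟨dy, by rw [← hy, mul_comm]⟩,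
    ⟨d 0, by rw [← h0, mul_comm]⟩, fun i hi => ⟨d (i + 1), by rw [← hs i hi, mul_comm]⟩,
    fun c h1 h2 h3 => hprim c h1 h2 fun i _ => h3 i⟩

theorem IsArith.label_eq {N dx dy rx ry : ℕ} {d r : ℕ → ℕ}
    (h : IsArith (N + 3) dx dy d rx ry r) (hr : ∀ i, N < i → r i = 0)
    (hd : ∀ i, N < i → d i = 0) :
    dx = r 0 / rx ∧ dy = r 0 / ry ∧ d = bidentLabel rx ry r := by
  have h0 := h.zero_mul' hr
  have hs := fun i hi => h.succ_mul hr (i := i) hi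
  obtain ⟨-, -, -, -, hrx, hry, hpos, hx, hy, -⟩ := h
  refine ⟨(Nat.div_eq_of_eq_mul_left hrx hx.symm).symm,
    (Nat.div_eq_of_eq_mul_left hry hy.symm).symm, funext fun i => ?_⟩
  unfold bidentLabel
  split_ifs with hi
  · rw [hi, ← h0, Nat.mul_div_cancel _ (hpos 0 (by omega))]
  · obtain ⟨i, rfl⟩ := Nat.exists_eq_succ_of_ne_zero hi
    rcases Nat.lt_or_ge i N with hlt | hge
    · simp only [Nat.succ_eq_add_one, Nat.add_sub_cancel]
      rw [← hs i hlt, Nat.mul_div_cancel _ (hpos _ (by simpa using hlt))]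
    · rw [hd _ (by omega), hr i.succ (by omega), Nat.div_zero]

theorem IsBidentVec.bidentLabel_zero_mul {N rx ry : ℕ} {r : ℕ → ℕ} (h : IsBidentVec N rx ry r) :
    bidentLabel rx ry r 0 * r 0 = rx + ry + r 1 :=
  Nat.div_mul_cancel h.dvd_zero

theorem IsBidentVec.bidentLabel_succ_mul {N rx ry : ℕ} {r : ℕ → ℕ} (h : IsBidentVec N rx ry r)
    {i : ℕ} (hi : i < N) :
    bidentLabel rx ry r (i + 1) * r (i + 1) = r i + r (i + 2) :=
  Nat.div_mul_cancel (h.dvd i hi)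

theorem IsBidentVec.isArith {N rx ry : ℕ} {r : ℕ → ℕ} (h : IsBidentVec N rx ry r) :
    IsArith (N + 3) (r 0 / rx) (r 0 / ry) (bidentLabel rx ry r) rx ry r := by
  have h0 := h.bidentLabel_zero_mul
  have hpos0 := h.pos 0 N.zero_le
  have hs := fun i hi => h.bidentLabel_succ_mul (i := i) hi
  refine ⟨by omega, Nat.div_pos (Nat.le_of_dvd hpos0 h.dvd_x) h.rx_pos,
    Nat.div_pos (Nat.le_of_dvd hpos0 h.dvd_y) h.ry_pos, ?_, h.rx_pos, h.ry_pos, h.pos,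
    Nat.div_mul_cancel h.dvd_x, Nat.div_mul_cancel h.dvd_y, fun _ => h0, ?_, ?_, ?_, ?_⟩
  · rintro (_ | i) hi
    · refine Nat.pos_of_mul_pos_right (b := r 0) ?_
      rw [h0]
      have := h.rx_pos
      omega
    · refine Nat.pos_of_mul_pos_right (b := r (i + 1)) ?_
      rw [hs i (by simpa using hi)]
      have := h.pos i (by simp at hi; omega)
      omega
  · intro hN
    rw [h0, h.pad 1 (by simp at hN; omega), add_zero]
  · rintro (_ | i) hi hiN
    · omega
    · exact hs i (by simp at hiN; omega)
  · simp only [Nat.add_sub_cancel]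
    intro hN
    obtain ⟨M, rfl⟩ := Nat.exists_eq_add_of_le' hN
    rw [hs M (by omega), h.pad (M + 2) (by omega)]
    simp
  · intro c hx hy hc
    refine h.primitive c hx hy fun i => ?_
    rcases Nat.lt_or_ge N i with hi | hi
    · simp [h.pad i hi]
    · exact hc i hi

theorem IsBidentVec.bidentLabel_pad {N rx ry : ℕ} {r : ℕ → ℕ} (h : IsBidentVec N rx ry r)
    {i : ℕ} (hi : N < i) : bidentLabel rx ry r i = 0 := by
  simp [bidentLabel, h.pad i hi, show i ≠ 0 by omega]

theorem IsArith.isSmooth_iff {N dx dy rx ry : ℕ} {d r : ℕ → ℕ}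
    (h : IsArith (N + 3) dx dy d rx ry r) (hr : ∀ i, N < i → r i = 0) :
    IsSmooth (N + 3) dx dy d ↔
      rx ≠ r 0 ∧ ry ≠ r 0 ∧ ∀ i, i < N → r (i + 1) ≠ r i + r (i + 2) := by
  have hs := fun i hi => h.succ_mul hr (i := i) hi
  obtain ⟨-, hdx, hdy, hd, hrx, hry, hpos, hx, hy, -⟩ := h
  have key : ∀ {a b c : ℕ}, 0 < a → 0 < b → a * b = c → (2 ≤ a ↔ b ≠ c) := by
    intro a b c ha hb hab
    rw [← hab, Ne, eq_comm, Nat.mul_eq_right hb.ne']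
    omega
  refine and_congr (key hdx hrx hx) (and_congr (key hdy hry hy)
    ⟨fun H i hi => ?_, fun H i h1 hi => ?_⟩)
  · exact (key (hd _ (by simpa using hi)) (hpos _ (by simpa using hi)) (hs i hi)).1
      (H (i + 1) (by omega) (by simpa using hi))
  · obtain ⟨i, rfl⟩ := Nat.exists_eq_add_of_le' h1
    have hi' : i < N := by simpa using hi
    exact (key (hd _ hi) (hpos _ hi) (hs i hi')).2 (H i hi')

/-- The bident vectors whose first `j` tail labels are different from `1`. -/
def bidentVecs (N j : ℕ) : Set (ℕ × ℕ × (ℕ → ℕ)) :=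
  {p | IsBidentVec N p.1 p.2.1 p.2.2 ∧ ∀ i, i < j → p.2.2 (i + 1) ≠ p.2.2 i + p.2.2 (i + 2)}

/-- The bident vectors of smooth arithmetical structures. -/
def smoothBidentVecs (N : ℕ) : Set (ℕ × ℕ × (ℕ → ℕ)) :=
  {p | p ∈ bidentVecs N N ∧ p.1 ≠ p.2.2 0 ∧ p.2.1 ≠ p.2.2 0}

theorem card_arithOn (N : ℕ) : Nat.card (ArithOn (N + 3)) = (bidentVecs N 0).ncard := by
  refine Nat.card_eq_of_bijective
    (fun a => ⟨(a.rx, a.ry, a.r), a.arith.isBidentVec a.r_pad, by simp⟩) ⟨?_, ?_⟩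
  · rintro ⟨dx, dy, d, rx, ry, r, h, hd, hr⟩ ⟨dx', dy', d', rx', ry', r', h', hd', hr'⟩ he
    obtain ⟨rfl, rfl, rfl⟩ : rx = rx' ∧ ry = ry' ∧ r = r' := by
      simpa using congrArg Subtype.val he
    obtain ⟨rfl, rfl, rfl⟩ := h.label_eq hr hd
    obtain ⟨rfl, rfl, rfl⟩ := h'.label_eq hr hd'
    rfl
  · rintro ⟨⟨rx, ry, r⟩, h, -⟩
    exact ⟨⟨_, _, _, rx, ry, r, h.isArith, fun i hi => h.bidentLabel_pad hi, h.pad⟩, rfl⟩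

theorem card_smoothArithOn (N : ℕ) :
    Nat.card (SmoothArithOn (N + 3)) = (smoothBidentVecs N).ncard := by
  refine Nat.card_eq_of_bijective
    (fun a => ⟨(a.rx, a.ry, a.r),
      ⟨a.arith.isBidentVec a.r_pad, ((a.arith.isSmooth_iff a.r_pad).1 a.smooth).2.2⟩,
      ((a.arith.isSmooth_iff a.r_pad).1 a.smooth).1,
      ((a.arith.isSmooth_iff a.r_pad).1 a.smooth).2.1⟩) ⟨?_, ?_⟩
  · rintro ⟨dx, dy, d, rx, ry, r, h, hs, hd, hr⟩
      ⟨dx', dy', d', rx', ry', r', h', hs', hd', hr'⟩ he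
    obtain ⟨rfl, rfl, rfl⟩ : rx = rx' ∧ ry = ry' ∧ r = r' := by
      simpa using congrArg Subtype.val he
    obtain ⟨rfl, rfl, rfl⟩ := h.label_eq hr hd
    obtain ⟨rfl, rfl, rfl⟩ := h'.label_eq hr hd'
    rfl
  · rintro ⟨⟨rx, ry, r⟩, ⟨h, hs⟩, hx, hy⟩
    exact ⟨⟨_, _, _, rx, ry, r, h.isArith, (h.isArith.isSmooth_iff h.pad).2 ⟨hx, hy, hs⟩,
      fun i hi => h.bidentLabel_pad hi, h.pad⟩, rfl⟩

theorem cross_eq_of_label_le {N rx ry rx' ry' dx dy dx' dy' : ℕ} {r r' d d' : ℕ → ℕ}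
    (h : IsBidentVec N rx ry r) (h' : IsBidentVec N rx' ry' r')
    (hx : dx * rx = r 0) (hy : dy * ry = r 0) (hx' : dx' * rx' = r' 0) (hy' : dy' * ry' = r' 0)
    (h0 : d 0 * r 0 = rx + ry + r 1) (h0' : d' 0 * r' 0 = rx' + ry' + r' 1)
    (hs : ∀ i, i < N → d (i + 1) * r (i + 1) = r i + r (i + 2))
    (hs' : ∀ i, i < N → d' (i + 1) * r' (i + 1) = r' i + r' (i + 2))
    (hdx : dx ≤ dx') (hdy : dy ≤ dy') (hd : ∀ i, i ≤ N → d i ≤ d' i) :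
    r 0 * rx' = r' 0 * rx ∧ r 0 * ry' = r' 0 * ry ∧ ∀ i, r 0 * r' i = r' 0 * r i := by
  zify at hx hy hx' hy' h0 h0' hdx hdy ⊢
  set W : ℕ → ℤ := fun i => r i * r' (i + 1) - r (i + 1) * r' i with hW
  have hWN : W N = 0 := by simp [hW, h.pad (N + 1) (by omega), h'.pad (N + 1) (by omega)]
  have hstep : ∀ i, i < N → W i ≤ W (i + 1) := by
    intro i hi
    have e1 : (d (i + 1) * r (i + 1) : ℤ) = r i + r (i + 2) := by exact_mod_cast hs i hi
    have e2 : (d' (i + 1) * r' (i + 1) : ℤ) = r' i + r' (i + 2) := by exact_mod_cast hs' i hi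
    have e3 : (0 : ℤ) ≤ (d' (i + 1) - d (i + 1)) * (r (i + 1) * r' (i + 1)) :=
      mul_nonneg (sub_nonneg.2 (Int.ofNat_le.2 (hd _ hi))) (by positivity)
    have : W (i + 1) - W i = (d' (i + 1) - d (i + 1)) * (r (i + 1) * r' (i + 1)) := by
      simp only [hW]
      linear_combination (r' (i + 1) : ℤ) * e1 - (r (i + 1) : ℤ) * e2
    linarith
  have hx0 : (r 0 : ℤ) * rx' - r' 0 * rx ≤ 0 := by
    have e : (0 : ℤ) ≤ (dx' - dx) * (rx * rx') := mul_nonneg (sub_nonneg.2 hdx) (by positivity)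
    rw [← hx, ← hx']
    linarith
  have hy0 : (r 0 : ℤ) * ry' - r' 0 * ry ≤ 0 := by
    have e : (0 : ℤ) ≤ (dy' - dy) * (ry * ry') := mul_nonneg (sub_nonneg.2 hdy) (by positivity)
    rw [← hy, ← hy']
    linarith
  have hsum : 0 ≤ ((r 0 : ℤ) * rx' - r' 0 * rx) + (r 0 * ry' - r' 0 * ry) + W 0 := by
    have e : (0 : ℤ) ≤ (d' 0 - d 0) * (r 0 * r' 0) :=
      mul_nonneg (sub_nonneg.2 (Int.ofNat_le.2 (hd 0 N.zero_le))) (by positivity)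
    have : ((r 0 : ℤ) * rx' - r' 0 * rx) + (r 0 * ry' - r' 0 * ry) + W 0
        = (d' 0 - d 0) * (r 0 * r' 0) := by
      simp only [hW]
      linear_combination (r' 0 : ℤ) * h0 - (r 0 : ℤ) * h0'
    linarith
  have hle : ∀ i, i ≤ N → W i ≤ 0 := by
    intro i hi
    induction hi using Nat.decreasingInduction with
    | self => exact hWN.le
    | of_succ i hi ih => exact (hstep i hi).trans ih
  have hge : ∀ i, i ≤ N → 0 ≤ W i := by
    intro i hi
    induction i with
    | zero => linarith
    | succ i ih => exact (ih (by omega)).trans (hstep i hi)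
  have hW0 := hle 0 N.zero_le
  refine ⟨by linarith, by linarith, fun i => ?_⟩
  rcases Nat.lt_or_ge N i with hi | hi
  · simp [h.pad i hi, h'.pad i hi]
  · induction i with
    | zero => ring
    | succ i ih =>
      have hWi : (r i : ℤ) * r' (i + 1) - r (i + 1) * r' i = 0 :=
        le_antisymm (hle i (by omega)) (hge i (by omega))
      have hri : (r i : ℤ) ≠ 0 := by exact_mod_cast (h.pos i (by omega)).ne'
      refine mul_left_cancel₀ hri ?_
      linear_combination (r 0 : ℤ) * hWi + (r (i + 1) : ℤ) * ih (by omega)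

theorem IsBidentVec.dvd_of_cross {N rx ry rx' ry' a b : ℕ} {r r' : ℕ → ℕ}
    (h : IsBidentVec N rx ry r) (ha : 0 < a)
    (hx : a * rx' = b * rx) (hy : a * ry' = b * ry) (hr : ∀ i, a * r' i = b * r i) : a ∣ b := by
  obtain ⟨a', b', hab, ea, eb⟩ := Nat.exists_coprime a b
  set g := Nat.gcd a b
  have hg : 0 < g := Nat.gcd_pos_of_pos_left _ ha
  have key : ∀ {u v : ℕ}, a * v = b * u → a' ∣ u := by
    intro u v huv
    refine hab.dvd_of_dvd_mul_left ⟨v, ?_⟩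
    refine Nat.eq_of_mul_eq_mul_right hg ?_
    rw [ea, eb] at huv
    linarith
  have h1 : a' = 1 := h.primitive a' (key hx) (key hy) fun i => key (hr i)
  rw [ea, h1, one_mul]
  exact Nat.gcd_dvd_right a b

/-- The labels of the arithmetical structure attached to a vector. -/
def bidentLabels (N : ℕ) (p : ℕ × ℕ × (ℕ → ℕ)) : ℕ × ℕ × (Fin (N + 1) → ℕ) :=
  (p.2.2 0 / p.1, p.2.2 0 / p.2.1, fun i => bidentLabel p.1 p.2.1 p.2.2 i)

theorem eq_of_bidentLabels_le {N : ℕ} {p q : ℕ × ℕ × (ℕ → ℕ)}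
    (hp : IsBidentVec N p.1 p.2.1 p.2.2) (hq : IsBidentVec N q.1 q.2.1 q.2.2)
    (hle : bidentLabels N p ≤ bidentLabels N q) : p = q := by
  obtain ⟨rx, ry, r⟩ := p
  obtain ⟨rx', ry', r'⟩ := q
  obtain ⟨hx, hy, hd⟩ := hle
  obtain ⟨ex, ey, er⟩ := cross_eq_of_label_le hp hq
    (Nat.div_mul_cancel hp.dvd_x) (Nat.div_mul_cancel hp.dvd_y)
    (Nat.div_mul_cancel hq.dvd_x) (Nat.div_mul_cancel hq.dvd_y)
    hp.bidentLabel_zero_mul hq.bidentLabel_zero_mul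
    (fun i hi => hp.bidentLabel_succ_mul hi) (fun i hi => hq.bidentLabel_succ_mul hi)
    hx hy (fun i hi => hd ⟨i, Nat.lt_succ_of_le hi⟩)
  dsimp only at *
  have hp0 := hp.pos 0 N.zero_le
  have hq0 := hq.pos 0 N.zero_le
  have e0 : r 0 = r' 0 := Nat.dvd_antisymm (hp.dvd_of_cross hp0 ex ey er)
    (hq.dvd_of_cross hq0 ex.symm ey.symm fun i => (er i).symm)
  rw [← e0] at ex ey er
  have hrr : r = r' := funext fun i => (Nat.eq_of_mul_eq_mul_left hp0 (er i)).symm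
  rw [Nat.eq_of_mul_eq_mul_left hp0 ex, Nat.eq_of_mul_eq_mul_left hp0 ey, hrr]

theorem finite_bidentVecs (N j : ℕ) : (bidentVecs N j).Finite := by
  by_contra hinf
  have f := Set.Infinite.natEmbedding _ hinf
  obtain ⟨m, n, hmn, hle⟩ := wellQuasiOrdered_le fun n => bidentLabels N (f n)
  exact hmn.ne (f.injective (Subtype.ext (eq_of_bidentLabels_le (f m).2.1 (f n).2.1 hle)))

/-- Insert the sum of the entries at `j` and `j + 1` between them. -/
def insertSum (j : ℕ) (r : ℕ → ℕ) (i : ℕ) : ℕ :=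
  if i ≤ j then r i else if i = j + 1 then r j + r (j + 1) else r (i - 1)

/-- Delete the entry at `j + 1`. -/
def deleteEntry (j : ℕ) (r : ℕ → ℕ) (i : ℕ) : ℕ :=
  if i ≤ j then r i else r (i + 1)

theorem deleteEntry_insertSum (j : ℕ) (r : ℕ → ℕ) : deleteEntry j (insertSum j r) = r := by
  funext i
  unfold deleteEntry insertSum
  split_ifs <;> first | rfl | omega

theorem insertSum_deleteEntry {j : ℕ} {r : ℕ → ℕ} (h : r (j + 1) = r j + r (j + 2)) :
    insertSum j (deleteEntry j r) = r := by
  funext i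
  rcases lt_trichotomy i (j + 1) with hi | rfl | hi
  · simp [insertSum, deleteEntry, Nat.lt_succ_iff.1 hi]
  · simp [insertSum, deleteEntry, h]
  · have h1 : ¬ i ≤ j := by omega
    have h2 : ¬ i - 1 ≤ j := by omega
    simp [insertSum, deleteEntry, h1, h2, hi.ne', show i - 1 + 1 = i by omega]

theorem IsBidentVec.deleteEntry {N rx ry j : ℕ} {r : ℕ → ℕ} (h : IsBidentVec (N + 1) rx ry r)
    (hj : j ≤ N) (hjs : r (j + 1) = r j + r (j + 2)) :
    IsBidentVec N rx ry (deleteEntry j r) where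
  rx_pos := h.rx_pos
  ry_pos := h.ry_pos
  pos i hi := by
    unfold _root_.deleteEntry
    split_ifs
    exacts [h.pos _ (by omega), h.pos _ (by omega)]
  pad i hi := by
    unfold _root_.deleteEntry
    rw [if_neg (by omega), h.pad _ (by omega)]
  dvd_x := by simpa [_root_.deleteEntry] using h.dvd_x
  dvd_y := by simpa [_root_.deleteEntry] using h.dvd_y
  dvd_zero := by
    rcases Nat.eq_zero_or_pos j with rfl | hj0
    · have := h.dvd_zero
      simp only [zero_add] at hjs
      rw [hjs, show rx + ry + (r 0 + r 2) = rx + ry + r 2 + r 0 by ring,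
        Nat.dvd_add_left dvd_rfl] at this
      simpa [_root_.deleteEntry] using this
    · simpa [_root_.deleteEntry, show 1 ≤ j by omega] using h.dvd_zero
  dvd i hi := by
    rcases lt_trichotomy (i + 1) j with hij | rfl | hij
    · simpa [_root_.deleteEntry, show i ≤ j by omega, show i + 1 ≤ j by omega,
        show i + 2 ≤ j by omega] using h.dvd i (by omega)
    · have := h.dvd i (by omega)
      rw [show i + 2 = i + 1 + 1 by rfl, hjs,
        show r i + (r (i + 1) + r (i + 1 + 2)) = r i + r (i + 3) + r (i + 1) by ring_nf,
        Nat.dvd_add_left dvd_rfl] at this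
      simpa [_root_.deleteEntry] using this
    · rcases Nat.lt_or_ge j i with hlt | hge
      · simpa [_root_.deleteEntry, show ¬ i ≤ j by omega, show ¬ i + 1 ≤ j by omega,
          show ¬ i + 2 ≤ j by omega] using h.dvd (i + 1) (by omega)
      · obtain rfl : i = j := by omega
        have := h.dvd (i + 1) (by omega)
        rw [hjs, show r i + r (i + 2) + r (i + 1 + 2) = r i + r (i + 3) + r (i + 2) by ring_nf,
          Nat.dvd_add_left dvd_rfl] at this
        simpa [_root_.deleteEntry] using this
  primitive c hx hy hc := by
    refine h.primitive c hx hy fun i => ?_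
    rw [← insertSum_deleteEntry hjs]
    unfold insertSum
    split_ifs
    exacts [hc _, dvd_add (hc _) (hc _), hc _]

theorem IsBidentVec.insertSum {N rx ry j : ℕ} {r : ℕ → ℕ} (h : IsBidentVec N rx ry r)
    (hj : j ≤ N) : IsBidentVec (N + 1) rx ry (insertSum j r) where
  rx_pos := h.rx_pos
  ry_pos := h.ry_pos
  pos i hi := by
    unfold _root_.insertSum
    split_ifs
    exacts [h.pos _ (by omega), Nat.add_pos_left (h.pos _ hj) _, h.pos _ (by omega)]
  pad i hi := by
    unfold _root_.insertSum
    rw [if_neg (by omega), if_neg (by omega), h.pad _ (by omega)]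
  dvd_x := by simpa [_root_.insertSum] using h.dvd_x
  dvd_y := by simpa [_root_.insertSum] using h.dvd_y
  dvd_zero := by
    rcases Nat.eq_zero_or_pos j with rfl | hj0
    · have := (Nat.dvd_add_left (dvd_refl (r 0))).2 h.dvd_zero
      rw [show rx + ry + r 1 + r 0 = rx + ry + (r 0 + r 1) by ring] at this
      simpa [_root_.insertSum] using this
    · simpa [_root_.insertSum, show 1 ≤ j by omega] using h.dvd_zero
  dvd i hi := by
    rcases lt_trichotomy (i + 1) j with hij | rfl | hij
    · simpa [_root_.insertSum, show i ≤ j by omega, show i + 1 ≤ j by omega,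
        show i + 2 ≤ j by omega] using h.dvd i (by omega)
    · have := (Nat.dvd_add_left (dvd_refl (r (i + 1)))).2 (h.dvd i (by omega))
      rw [show r i + r (i + 2) + r (i + 1) = r i + (r (i + 1) + r (i + 2)) by ring] at this
      simpa [_root_.insertSum] using this
    · rcases Nat.lt_trichotomy i (j + 1) with hlt | rfl | hgt
      · obtain rfl : i = j := by omega
        simp [_root_.insertSum]
      · have := (Nat.dvd_add_left (dvd_refl (r (j + 1)))).2 (h.dvd j (by omega))
        rw [show r j + r (j + 2) + r (j + 1) = r j + r (j + 1) + r (j + 2) by ring] at this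
        simpa [_root_.insertSum, show ¬ j + 1 + 2 ≤ j by omega] using this
      · obtain ⟨i, rfl⟩ := Nat.exists_eq_succ_of_ne_zero (show i ≠ 0 by omega)
        simpa [_root_.insertSum, show ¬ i + 1 ≤ j by omega, show ¬ i + 1 + 1 ≤ j by omega,
          show ¬ i + 1 + 2 ≤ j by omega, show i ≠ j by omega, show i + 1 ≠ j by omega,
          show i + 1 + 1 ≠ j by omega] using h.dvd i (by omega)
  primitive c hx hy hc := by
    refine h.primitive c hx hy fun i => ?_
    rw [← deleteEntry_insertSum j r]
    unfold _root_.deleteEntry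
    split_ifs
    exacts [hc _, hc _]

theorem ncard_bidentVecs_succ {N j : ℕ} (hj : j ≤ N) :
    (bidentVecs (N + 1) j).ncard = (bidentVecs (N + 1) (j + 1)).ncard +
      (bidentVecs N (j - 1)).ncard := by
  have hins : (bidentVecs N (j - 1)).ncard =
      (bidentVecs (N + 1) j \ bidentVecs (N + 1) (j + 1)).ncard := by
    refine Set.ncard_congr (fun p _ => (p.1, p.2.1, insertSum j p.2.2)) ?_ ?_ ?_
    · rintro ⟨rx, ry, r⟩ ⟨h, hne⟩
      refine ⟨⟨h.insertSum hj, fun i hi => ?_⟩, fun h' => ?_⟩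
      · rcases Nat.lt_or_ge (i + 1) j with hlt | hge
        · simpa [insertSum, show i ≤ j by omega, show i + 1 ≤ j by omega,
            show i + 2 ≤ j by omega] using hne i (by omega)
        · obtain rfl : j = i + 1 := by omega
          have : 0 < r i := h.pos i (by omega)
          simp [insertSum]
          omega
      · exact h'.2 j (by omega) (by simp [insertSum])
    · rintro ⟨rx, ry, r⟩ ⟨rx', ry', r'⟩ - - heq
      simp only [Prod.mk.injEq] at heq
      obtain ⟨rfl, rfl, heq⟩ := heq
      rw [← deleteEntry_insertSum j r, heq, deleteEntry_insertSum]
    · rintro ⟨rx, ry, r⟩ ⟨⟨h, hne⟩, hnot⟩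
      have hjs : r (j + 1) = r j + r (j + 2) := by
        by_contra hcon
        refine hnot ⟨h, fun i hi => ?_⟩
        rcases Nat.lt_succ_iff_lt_or_eq.1 hi with hlt | rfl
        exacts [hne i hlt, hcon]
      refine ⟨(rx, ry, deleteEntry j r), ⟨h.deleteEntry hj hjs, fun i hi => ?_⟩, ?_⟩
      · simpa [deleteEntry, show i ≤ j by omega, show i + 1 ≤ j by omega,
          show i + 2 ≤ j by omega] using hne i (by omega)
      · simp [insertSum_deleteEntry hjs]
  have hsub : bidentVecs (N + 1) (j + 1) ⊆ bidentVecs (N + 1) j :=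
    fun p hp => ⟨hp.1, fun i hi => hp.2 i (by omega)⟩
  rw [hins, add_comm (Set.ncard _), Set.ncard_sdiff_add_ncard_of_subset hsub (finite_bidentVecs _ _)]

theorem IsBidentVec.swap {N rx ry : ℕ} {r : ℕ → ℕ} (h : IsBidentVec N rx ry r) :
    IsBidentVec N ry rx r :=
  ⟨h.ry_pos, h.rx_pos, h.pos, h.pad, h.dvd_y, h.dvd_x, by rw [add_comm ry rx]; exact h.dvd_zero,
    h.dvd, fun c hx hy hc => h.primitive c hy hx hc⟩

theorem IsBidentVec.strictAnti {N rx ry : ℕ} {r : ℕ → ℕ} (h : IsBidentVec N rx ry r)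
    (hs : ∀ i, i < N → r (i + 1) ≠ r i + r (i + 2)) {i : ℕ} (hi : i ≤ N) : r (i + 1) < r i := by
  induction hi using Nat.decreasingInduction with
  | self =>
    rw [h.pad _ N.lt_succ_self]
    exact h.pos N le_rfl
  | of_succ i hi ih =>
    obtain ⟨c, hc⟩ := h.dvd i hi
    have hpos := h.pos i hi.le
    have hne := hs i hi
    have hc2 : 2 ≤ c := by
      rcases c with _ | _ | c
      · simp at hc
        omega
      · rw [zero_add, mul_one] at hc
        exact absurd hc.symm hne
      · omega
    have := Nat.mul_le_mul_left (r (i + 1)) hc2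
    have ih' : r (i + 2) < r (i + 1) := ih
    omega

theorem eq_of_dvd_of_lt_two_mul {a b : ℕ} (hb : 0 < b) (hab : a ∣ b) (hlt : b < 2 * a) :
    b = a := by
  obtain ⟨c, rfl⟩ := hab
  have hc : c < 2 := by
    by_contra hc
    have := Nat.mul_le_mul_left a (not_lt.1 hc)
    omega
  interval_cases c
  · simp at hb
  · rw [mul_one]

theorem IsBidentVec.eq_of_rx_eq {N ry : ℕ} {r : ℕ → ℕ} (h : IsBidentVec N (r 0) ry r)
    (hs : ∀ i, i < N → r (i + 1) ≠ r i + r (i + 2)) : ry = 1 ∧ r = fun i => N + 1 - i := by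
  have hstep : ∀ i, i ≤ N → r i = ry + r (i + 1) ∧ ry ∣ r i := by
    intro i hi
    induction i with
    | zero =>
      have h1 : r 1 < r 0 := h.strictAnti hs hi
      have h2 := Nat.le_of_dvd (h.pos 0 hi) h.dvd_y
      have h3 := h.dvd_zero
      have h4 := h.ry_pos
      rw [add_assoc, Nat.dvd_add_right dvd_rfl] at h3
      exact ⟨(eq_of_dvd_of_lt_two_mul (by omega) h3 (by omega)).symm, h.dvd_y⟩
    | succ i ih =>
      obtain ⟨e, hdvd⟩ := ih (by omega)
      have hdvd' : ry ∣ r (i + 1) := by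
        rwa [e, Nat.dvd_add_right dvd_rfl] at hdvd
      have h1 : r (i + 2) < r (i + 1) := h.strictAnti hs hi
      have h2 := Nat.le_of_dvd (h.pos _ hi) hdvd'
      have h3 := h.dvd i (by omega)
      have h4 := h.ry_pos
      rw [e, show ry + r (i + 1) + r (i + 2) = r (i + 1) + (ry + r (i + 2)) by ring,
        Nat.dvd_add_right dvd_rfl] at h3
      exact ⟨(eq_of_dvd_of_lt_two_mul (by omega) h3 (by omega)).symm, hdvd'⟩
  have hry : ry = 1 := by
    refine h.primitive ry h.dvd_y dvd_rfl fun i => ?_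
    rcases Nat.lt_or_ge N i with hi | hi
    · simp [h.pad i hi]
    · exact (hstep i hi).2
  subst hry
  refine ⟨rfl, funext fun i => ?_⟩
  rcases Nat.lt_or_ge N i with hi | hi
  · rw [h.pad i hi]
    omega
  · induction hi using Nat.decreasingInduction with
    | self =>
      rw [(hstep N le_rfl).1, h.pad _ N.lt_succ_self]
      omega
    | of_succ i hi ih =>
      rw [(hstep i hi.le).1, ih]
      omega

theorem isBidentVec_linear (N : ℕ) : IsBidentVec N (N + 1) 1 fun i => N + 1 - i where
  rx_pos := by omega
  ry_pos := by omega
  pos i hi := by omega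
  pad i hi := by omega
  dvd_x := by simp
  dvd_y := by simp
  dvd_zero := ⟨2, by omega⟩
  dvd i hi := ⟨2, by omega⟩
  primitive c _ hy _ := Nat.dvd_one.1 hy

theorem IsBidentVec.rx_eq_or_ry_eq_iff {N rx ry : ℕ} {r : ℕ → ℕ} :
    (IsBidentVec N rx ry r ∧ (∀ i, i < N → r (i + 1) ≠ r i + r (i + 2)) ∧ (rx = r 0 ∨ ry = r 0)) ↔
      (rx = N + 1 ∧ ry = 1 ∧ r = fun i => N + 1 - i) ∨
        (rx = 1 ∧ ry = N + 1 ∧ r = fun i => N + 1 - i) := by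
  constructor
  · rintro ⟨h, hs, rfl | rfl⟩
    · obtain ⟨rfl, rfl⟩ := h.eq_of_rx_eq hs
      simp
    · obtain ⟨rfl, rfl⟩ := h.swap.eq_of_rx_eq hs
      simp
  · have hs : ∀ i, i < N → N + 1 - (i + 1) ≠ N + 1 - i + (N + 1 - (i + 2)) := by
      intro i hi
      omega
    rintro (⟨rfl, rfl, rfl⟩ | ⟨rfl, rfl, rfl⟩)
    · exact ⟨isBidentVec_linear N, hs, Or.inl rfl⟩
    · exact ⟨(isBidentVec_linear N).swap, hs, Or.inr rfl⟩

theorem bidentVecs_diff_smoothBidentVecs (N : ℕ) :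
    bidentVecs N N \ smoothBidentVecs N =
      {(N + 1, 1, fun i => N + 1 - i), (1, N + 1, fun i => N + 1 - i)} := by
  ext ⟨rx, ry, r⟩
  have := IsBidentVec.rx_eq_or_ry_eq_iff (N := N) (rx := rx) (ry := ry) (r := r)
  simp only [Set.mem_sdiff, smoothBidentVecs, bidentVecs, Set.mem_ofPred_eq, Set.mem_insert_iff,
    Set.mem_singleton_iff, Prod.mk.injEq, ← this]
  tauto

theorem ncard_bidentVecs_diag_eq (N : ℕ) :
    (bidentVecs N N).ncard = (smoothBidentVecs N).ncard +
      (bidentVecs N N \ smoothBidentVecs N).ncard := by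
  rw [add_comm, Set.ncard_sdiff_add_ncard_of_subset (fun p hp => hp.1) (finite_bidentVecs N N)]

theorem ncard_bidentVecs_diag {N : ℕ} (hN : 0 < N) :
    (bidentVecs N N).ncard = (smoothBidentVecs N).ncard + 2 := by
  rw [ncard_bidentVecs_diag_eq, bidentVecs_diff_smoothBidentVecs, Set.ncard_pair]
  simp [hN.ne']

theorem smoothBidentVecs_zero :
    smoothBidentVecs 0 = {(1, 1, fun i => if i = 0 then 2 else 0)} := by
  ext ⟨rx, ry, r⟩
  simp only [smoothBidentVecs, bidentVecs, Set.mem_ofPred_eq, Set.mem_singleton_iff, Prod.mk.injEq]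
  constructor
  · rintro ⟨⟨h, -⟩, hx, hy⟩
    have h0 := h.pos 0 le_rfl
    have hxpos := h.rx_pos
    have hypos := h.ry_pos
    have half : ∀ {a b : ℕ}, 0 < b → a ∣ b → a ≠ b → 2 * a ≤ b := by
      rintro a b hb hab hne
      by_contra hlt
      exact hne (eq_of_dvd_of_lt_two_mul hb hab (by omega)).symm
    have hx2 := half h0 h.dvd_x hx
    have hy2 := half h0 h.dvd_y hy
    have hle := Nat.le_of_dvd (by omega) h.dvd_zero
    have hr1 := h.pad 1 one_pos
    obtain rfl : rx = ry := by omega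
    have hr0 : r 0 = 2 * rx := by omega
    have h1 : rx = 1 := by
      refine h.primitive rx dvd_rfl dvd_rfl fun i => ?_
      rcases Nat.eq_zero_or_pos i with rfl | hi
      · exact h.dvd_x
      · simp [h.pad i hi]
    subst h1
    refine ⟨rfl, rfl, funext fun i => ?_⟩
    split_ifs with hi
    · rw [hi, hr0]
    · exact h.pad i (Nat.pos_of_ne_zero hi)
  · rintro ⟨rfl, rfl, rfl⟩
    refine ⟨⟨⟨one_pos, one_pos, ?_, ?_, by simp, by simp, by simp, by simp,
      fun c hc _ _ => Nat.dvd_one.1 hc⟩, by simp⟩, by simp, by simp⟩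
    · intro i hi
      simp [Nat.le_zero.1 hi]
    · intro i hi
      simp [hi.ne']

theorem ncard_bidentVecs_zero : (bidentVecs 0 0).ncard = 2 := by
  rw [ncard_bidentVecs_diag_eq, bidentVecs_diff_smoothBidentVecs, smoothBidentVecs_zero]
  simp

theorem ncard_bidentVecs_eq_sum (N : ℕ) :
    (bidentVecs N 0).ncard =
      ∑ s ∈ Finset.range (N + 1), ballot N (N - s) * (bidentVecs s s).ncard := by
  have h := eq_sum_insertionCount (Y := fun N j => (bidentVecs N j).ncard)
    (fun N j hj => ncard_bidentVecs_succ hj) N 0 N.zero_le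
  zify
  rw [h]
  refine Finset.sum_congr rfl fun s hs => ?_
  rw [insertionCount_zero_eq_ballot (Finset.mem_range_succ_iff.1 hs)]

/-- **Theorem 2.12.**  For `n ≥ 3`, the number of arithmetical structures on the bident
`D_n` is `2·C(n-2) + ∑_{m=4}^{n} B(n-3, n-m)·|SArith(D_m)|`, where `C` is the Catalan
number and `B` the ballot number. -/
theorem card_arith_bident (n : ℕ) (hn : 3 ≤ n) :
    Nat.card (ArithOn n) =
      2 * catalan (n - 2) +
        ∑ m ∈ Finset.Icc 4 n, ballot (n - 3) (n - m) * Nat.card (SmoothArithOn m) := by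
  obtain ⟨N, rfl⟩ := Nat.exists_eq_add_of_le' hn
  have hcat : ∑ s ∈ Finset.range (N + 1), ballot N (N - s) = catalan (N + 1) := by
    rw [← sum_range_ballot_eq_catalan, ← Finset.sum_range_reflect (ballot N)]
    rfl
  have hIcc : Finset.Icc 4 (N + 3) = (Finset.range N).map (addRightEmbedding 4) := by
    rw [Finset.range_eq_Ico, Finset.map_add_right_Ico]
    rfl
  rw [card_arithOn, ncard_bidentVecs_eq_sum, hIcc, Finset.sum_map, show N + 3 - 2 = N + 1 by rfl,
    ← hcat, Finset.sum_range_succ', Finset.sum_range_succ' _ N, ncard_bidentVecs_zero, mul_add,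
    Finset.mul_sum, add_right_comm, ← Finset.sum_add_distrib, mul_comm _ 2]
  congr 1
  refine Finset.sum_congr rfl fun s hs => ?_
  rw [ncard_bidentVecs_diag s.succ_pos, addRightEmbedding_apply, Nat.add_sub_cancel,
    show s + 4 = s + 1 + 3 by rfl, card_smoothArithOn, Nat.add_sub_add_right]
  ring
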